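/- Let β ∈ V_1 ⊖ S_1 and let n ≥ 0 be an integer. Then in ℓ²(W): h(β_{0,n}) = β_{1,n} + p·β_{0,n} − β_{0,n−1} (with β_{0,−1} = 0). -/

import Mathlib

noncomputable section

open scoped ComplexInnerProductSpace

namespace UCoxMasa

/-- The universal Coxeter matrix on `Fin L`: all off-diagonal entries are `0` (representing ∞). -/
def Mat (L : ℕ) : CoxeterMatrix (Fin L) where
  M := fun i j => if i = j then 1 else 0
  isSymm := by
    ext i j
    by_cases h : i = j <;> simp [Matrix.transpose, h, eq_comm]
  diagonal := fun i => by simp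
  off_diagonal := fun i j h => by simp [h]

/-- The universal Coxeter group on `L` generators: free product of `L` copies of `ℤ/2ℤ`. -/
abbrev W (L : ℕ) : Type := (Mat L).Group

/-- The distinguished Coxeter system of `W L`. -/
def cs (L : ℕ) : CoxeterSystem (Mat L) (W L) := CoxeterMatrix.toCoxeterSystem (Mat L)

/-- The simple reflection associated to `i : Fin L`. -/
def σ {L : ℕ} (i : Fin L) : W L := (cs L).simple i

/-- Word length on `W L` with respect to the generating set of simple reflections. -/
def len {L : ℕ} (w : W L) : ℕ := (cs L).length w

/-- The Hilbert space `ℓ²(W)`. -/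
abbrev H (L : ℕ) : Type := lp (fun _ : W L => ℂ) 2

/-- The standard orthonormal basis vector `δ_w` of `ℓ²(W)`. -/
def δ {L : ℕ} (w : W L) : H L :=
  letI := Classical.decEq (W L)
  lp.single 2 w 1

/-- `V l`: the linear span of `{δ_w : ℓ(w) = l}`. -/
def V (L : ℕ) (l : ℕ) : Submodule ℂ (H L) :=
  Submodule.span ℂ {x : H L | ∃ w : W L, len w = l ∧ x = δ w}

/-- `S_l`: the linear span of `q_l(h V_{l-1}) ∪ q_l(R_h V_{l-1})`,
given the projections `Q`, the operator `h` and the right operator `Rh`. -/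
def Sl (L : ℕ) (Q : ℕ → (H L →L[ℂ] H L)) (h Rh : H L →L[ℂ] H L) (l : ℕ) :
    Submodule ℂ (H L) :=
  Submodule.span ℂ
    ({x : H L | ∃ y ∈ V L (l - 1), x = Q l (h y)} ∪
      {x : H L | ∃ y ∈ V L (l - 1), x = Q l (Rh y)})

end UCoxMasa


namespace UCoxMasa

/-! ### Reduced words -/

/-- Words without two equal adjacent letters. -/
abbrev RedWord (L : ℕ) : Type := {l : List (Fin L) // l.IsChain (· ≠ ·)}

/-- Left multiplication of a reduced word by a letter, followed by reduction. -/
def letterMul {L : ℕ} (s : Fin L) (l : List (Fin L)) : List (Fin L) :=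
  if l.head? = some s then l.tail else s :: l

lemma isChain_letterMul {L : ℕ} (s : Fin L) {l : List (Fin L)} (hl : l.IsChain (· ≠ ·)) :
    (letterMul s l).IsChain (· ≠ ·) := by
  unfold letterMul
  split_ifs with h
  · exact hl.tail
  · cases l with
    | nil => simp
    | cons a l =>
      simp only [List.head?_cons, Option.some.injEq] at h
      exact List.isChain_cons_cons.2 ⟨Ne.symm h, hl⟩

lemma letterMul_letterMul {L : ℕ} (s : Fin L) {l : List (Fin L)} (hl : l.IsChain (· ≠ ·)) :
    letterMul s (letterMul s l) = l := by
  cases l with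
  | nil => simp [letterMul]
  | cons a l =>
    by_cases h : a = s
    · subst h
      cases l with
      | nil => simp [letterMul]
      | cons b l =>
        have hab : a ≠ b := (List.isChain_cons_cons.1 hl).1
        simp [letterMul, hab.symm]
    · simp [letterMul, h]

/-- The involution of the reduced words given by a letter. -/
def letterPerm {L : ℕ} (s : Fin L) : Equiv.Perm (RedWord L) where
  toFun l := ⟨letterMul s l, isChain_letterMul s l.2⟩
  invFun l := ⟨letterMul s l, isChain_letterMul s l.2⟩
  left_inv l := Subtype.ext (letterMul_letterMul s l.2)
  right_inv l := Subtype.ext (letterMul_letterMul s l.2)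

lemma letterPerm_isLiftable {L : ℕ} : (Mat L).IsLiftable (letterPerm (L := L)) := by
  intro i j
  by_cases h : i = j
  · subst h
    have : (letterPerm i * letterPerm i : Equiv.Perm (RedWord L)) = 1 :=
      Equiv.ext fun l => Subtype.ext (letterMul_letterMul i l.2)
    rw [this, one_pow]
  · have : (Mat L).M i j = 0 := by simp [Mat, h]
    rw [this, pow_zero]

/-- The reduced word of an element of `W L`. -/
def redWord {L : ℕ} (w : W L) : List (Fin L) :=
  ((cs L).lift ⟨letterPerm, letterPerm_isLiftable⟩ w ⟨[], List.isChain_nil⟩).1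

lemma redWord_one {L : ℕ} : redWord (1 : W L) = [] := by simp [redWord]

lemma redWord_simple_mul {L : ℕ} (s : Fin L) (w : W L) :
    redWord (σ s * w) = letterMul s (redWord w) := by
  simp only [redWord, σ, map_mul, CoxeterSystem.lift_apply_simple]
  rfl

lemma wordProd_letterMul {L : ℕ} (s : Fin L) (l : List (Fin L)) :
    (cs L).wordProd (letterMul s l) = σ s * (cs L).wordProd l := by
  cases l with
  | nil => simp [letterMul, σ]
  | cons a l =>
    by_cases h : a = s
    · subst h
      simp [letterMul, σ, CoxeterSystem.wordProd_cons]
    · simp [letterMul, h, σ, CoxeterSystem.wordProd_cons]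

lemma wordProd_redWord {L : ℕ} (w : W L) : (cs L).wordProd (redWord w) = w := by
  induction w using (cs L).simple_induction_left with
  | one => simp [redWord_one]
  | mul_simple_left w i ih =>
    rw [show (cs L).simple i = σ i from rfl, redWord_simple_mul, wordProd_letterMul, ih]

lemma length_letterMul_le {L : ℕ} (s : Fin L) (l : List (Fin L)) :
    (letterMul s l).length ≤ l.length + 1 := by
  unfold letterMul
  split_ifs <;> grind

lemma length_redWord_wordProd_le {L : ℕ} (l : List (Fin L)) :
    (redWord ((cs L).wordProd l)).length ≤ l.length := by
  induction l with
  | nil => simp [redWord_one]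
  | cons a l ih =>
    rw [CoxeterSystem.wordProd_cons, show (cs L).simple a = σ a from rfl, redWord_simple_mul]
    have := length_letterMul_le a (redWord ((cs L).wordProd l))
    simp only [List.length_cons]
    omega

lemma len_eq_length_redWord {L : ℕ} (w : W L) : len w = (redWord w).length := by
  apply le_antisymm
  · conv_lhs => rw [← wordProd_redWord w]
    exact (cs L).length_wordProd_le _
  · obtain ⟨l, hl, rfl⟩ := (cs L).exists_isReduced w
    have := length_redWord_wordProd_le l
    rw [← hl.eq] at this
    exact this

lemma len_simple_mul_lt_iff {L : ℕ} (s : Fin L) (w : W L) :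
    len (σ s * w) < len w ↔ (redWord w).head? = some s := by
  rw [len_eq_length_redWord, len_eq_length_redWord, redWord_simple_mul]
  unfold letterMul
  split_ifs with h
  · cases hw : redWord w with
    | nil => simp [hw] at h
    | cons a l => simpa [hw] using h
  · simp [h]

lemma len_one {L : ℕ} : len (1 : W L) = 0 :=
  (cs L).length_one

lemma len_simple_mul {L : ℕ} (s : Fin L) (w : W L) :
    len (σ s * w) = len w + 1 ∨ len (σ s * w) + 1 = len w :=
  (cs L).length_simple_mul w s

lemma len_mul_simple {L : ℕ} (s : Fin L) (w : W L) :
    len (w * σ s) = len w + 1 ∨ len (w * σ s) + 1 = len w :=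
  (cs L).length_mul_simple w s

lemma simple_mul_cancel {L : ℕ} (s : Fin L) (w : W L) : σ s * (σ s * w) = w :=
  (cs L).simple_mul_simple_cancel_left s

lemma simple_injective {L : ℕ} : Function.Injective (σ : Fin L → W L) := by
  intro s t h
  have hs := redWord_simple_mul s 1
  have ht := redWord_simple_mul t 1
  rw [mul_one, redWord_one] at hs ht
  rw [h, ht] at hs
  simpa [letterMul, eq_comm] using hs

/-- The sphere of radius `n` in `W L`. -/
def sphere (L n : ℕ) : Finset (W L) :=
  letI := Classical.decEq (W L)
  (Finset.univ : Finset (List.Vector (Fin L) n)).image (fun v => (cs L).wordProd v.1)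
    |>.filter (fun w => len w = n)

lemma mem_sphere {L n : ℕ} {w : W L} : w ∈ sphere L n ↔ len w = n := by
  classical
  simp only [sphere, Finset.mem_filter, Finset.mem_image, Finset.mem_univ, true_and,
    and_iff_right_iff_imp]
  intro h
  exact ⟨⟨redWord w, by rw [← len_eq_length_redWord, h]⟩, wordProd_redWord w⟩

lemma tsum_sphere {L n : ℕ} {M : Type*} [AddCommMonoid M] [TopologicalSpace M] (f : W L → M) :
    ∑' w : {w : W L // len w = n}, f w = ∑ w ∈ sphere L n, f w := by
  rw [← Finset.tsum_subtype (sphere L n) f]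
  exact ((Equiv.subtypeEquivRight fun w => (mem_sphere (n := n) (w := w)).symm).tsum_eq
    fun w : sphere L n => f w)

lemma sphere_zero {L : ℕ} : sphere L 0 = {1} := by
  ext w
  rw [mem_sphere, Finset.mem_singleton]
  exact (cs L).length_eq_zero_iff

lemma sum_sphere_one {L : ℕ} {M : Type*} [AddCommMonoid M] (f : W L → M) :
    ∑ w ∈ sphere L 1, f w = ∑ s : Fin L, f (σ s) := by
  symm
  refine Finset.sum_bij (fun s _ => σ s) ?_ (fun _ _ _ _ h => simple_injective h) ?_
    (fun _ _ => rfl)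
  · exact fun s _ => mem_sphere.2 ((cs L).length_simple s)
  · intro w hw
    obtain ⟨s, hs⟩ := (cs L).length_eq_one_iff.1 (mem_sphere.1 hw)
    exact ⟨s, Finset.mem_univ _, hs.symm⟩

lemma sum_sphere_succ_descent {L : ℕ} {M : Type*} [AddCommMonoid M] (n : ℕ) (s : Fin L)
    (f : W L → M) :
    ∑ v ∈ sphere L (n + 1), (if len (σ s * v) < len v then f v else 0) =
      ∑ u ∈ sphere L n, (if len (σ s * u) < len u then 0 else f (σ s * u)) := by
  classical
  simp only [← ite_not (len (σ s * _) < len _) (f _) 0]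
  rw [← Finset.sum_filter, ← Finset.sum_filter]
  refine Finset.sum_bij' (fun v _ => σ s * v) (fun u _ => σ s * u) ?_ ?_
    (fun _ _ => simple_mul_cancel s _) (fun _ _ => simple_mul_cancel s _) ?_
  · intro v hv
    have := len_simple_mul s v
    simp only [Finset.mem_filter, mem_sphere, simple_mul_cancel] at hv ⊢
    omega
  · intro v hv
    have := len_simple_mul s v
    simp only [Finset.mem_filter, mem_sphere, simple_mul_cancel] at hv ⊢
    omega
  · intro v _
    rw [simple_mul_cancel]

/-- The value of `c` at the first letter of the reduced word of `w`, and `0` for `w = 1`. -/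
def firstLetterCoeff {L : ℕ} (c : Fin L → ℂ) (w : W L) : ℂ :=
  ∑ s, if len (σ s * w) < len w then c s else 0

lemma sum_descent {L : ℕ} {M : Type*} [AddCommMonoid M] {w : W L} {s : Fin L}
    (hs : len (σ s * w) < len w) (f : Fin L → M) :
    ∑ t, (if len (σ t * w) < len w then f t else 0) = f s := by
  rw [len_simple_mul_lt_iff] at hs
  simp [len_simple_mul_lt_iff, hs]

lemma firstLetterCoeff_one {L : ℕ} (c : Fin L → ℂ) : firstLetterCoeff c 1 = 0 := by
  simp [firstLetterCoeff, len_one]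

lemma firstLetterCoeff_simple_mul {L : ℕ} (c : Fin L → ℂ) {w : W L} {s : Fin L}
    (hs : ¬ len (σ s * w) < len w) : firstLetterCoeff c (σ s * w) = c s := by
  refine sum_descent ?_ c
  have := len_simple_mul s w
  rw [simple_mul_cancel]
  omega

lemma sum_ascent {L : ℕ} {c : Fin L → ℂ} (hc : ∑ s, c s = 0) (w : W L) :
    ∑ s, (if len (σ s * w) < len w then 0 else c s) = -firstLetterCoeff c w := by
  rw [eq_neg_iff_add_eq_zero, firstLetterCoeff, ← Finset.sum_add_distrib]
  refine (Finset.sum_congr rfl ?_).trans hc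
  exact fun s _ => by split_ifs <;> simp

lemma exists_descent {L n : ℕ} {w : W L} (hw : len w = n + 1) :
    ∃ s : Fin L, len (σ s * w) < len w := by
  refine (cs L).exists_leftDescent_of_ne_one (w := w) ?_
  rintro rfl
  simp [len_one] at hw

/-! ### The vectors supported on spheres -/

lemma delta_mem_V {L : ℕ} {w : W L} {l : ℕ} (hw : len w = l) : δ w ∈ V L l :=
  Submodule.subset_span ⟨w, hw, rfl⟩

/-- The linear span of `{δ_w : ℓ(w) ≤ l}`. -/
def VLe (L l : ℕ) : Submodule ℂ (H L) :=
  Submodule.span ℂ {x : H L | ∃ w : W L, len w ≤ l ∧ x = δ w}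

lemma delta_mem_VLe {L : ℕ} {w : W L} {l : ℕ} (hw : len w ≤ l) : δ w ∈ VLe L l :=
  Submodule.subset_span ⟨w, hw, rfl⟩

lemma apply_mem_of_mem_VLe {L l : ℕ} {A : H L →L[ℂ] H L} {K : Submodule ℂ (H L)}
    (hA : ∀ w : W L, len w ≤ l → A (δ w) ∈ K) {x : H L} (hx : x ∈ VLe L l) : A x ∈ K := by
  have : VLe L l ≤ K.comap A.toLinearMap := by
    refine Submodule.span_le.2 ?_
    rintro _ ⟨w, hw, rfl⟩
    exact hA w hw
  exact this hx

lemma proj_of_mem_V {L l : ℕ} {Q : ℕ → H L →L[ℂ] H L}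
    (hQ : ∀ (l : ℕ) (w : W L), Q l (δ w) = if len w = l then δ w else 0)
    {x : H L} (hx : x ∈ V L l) (k : ℕ) : Q k x = if l = k then x else 0 := by
  induction hx using Submodule.span_induction with
  | mem x hx =>
    obtain ⟨w, rfl, rfl⟩ := hx
    exact hQ k w
  | zero => simp
  | add x y _ _ hx hy => rw [map_add, hx, hy]; split_ifs <;> simp
  | smul a x _ hx => rw [map_smul, hx]; split_ifs <;> simp

lemma proj_of_mem_VLe {L l k : ℕ} {Q : ℕ → H L →L[ℂ] H L}
    (hQ : ∀ (l : ℕ) (w : W L), Q l (δ w) = if len w = l then δ w else 0)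
    {x : H L} (hx : x ∈ VLe L l) (hlk : l < k) : Q k x = 0 := by
  rw [← Submodule.mem_bot ℂ]
  refine apply_mem_of_mem_VLe (fun w hw => ?_) hx
  rw [hQ, if_neg (by omega)]
  exact Submodule.zero_mem _

/-- The vector `∑ c (first letter of v) • δ_v`, the sum being over the sphere of radius `m`. -/
def firstLetterVector {L : ℕ} (c : Fin L → ℂ) (m : ℕ) : H L :=
  ∑ v ∈ sphere L m, firstLetterCoeff c v • δ v

lemma firstLetterVector_mem_V {L : ℕ} (c : Fin L → ℂ) (m : ℕ) :
    firstLetterVector c m ∈ V L m :=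
  Submodule.sum_mem _ fun _ hv => Submodule.smul_mem _ _ (delta_mem_V (mem_sphere.1 hv))

lemma firstLetterVector_zero {L : ℕ} (c : Fin L → ℂ) : firstLetterVector c 0 = 0 := by
  simp [firstLetterVector, sphere_zero, firstLetterCoeff_one]

lemma firstLetterVector_succ {L : ℕ} (c : Fin L → ℂ) (n : ℕ) :
    firstLetterVector c (n + 1) =
      ∑ s, c s • ∑ w ∈ sphere L n, if len (σ s * w) < len w then 0 else δ (σ s * w) := by
  simp only [← sum_sphere_succ_descent, firstLetterVector, firstLetterCoeff, Finset.smul_sum,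
    Finset.sum_smul]
  rw [Finset.sum_comm]
  simp only [ite_smul, smul_ite, zero_smul, smul_zero]

lemma exists_coeff_of_mem_V_one {L : ℕ} {β : H L} (hβ : β ∈ V L 1) :
    ∃ c : Fin L → ℂ, ∑ s, c s • δ (σ s) = β := by
  refine (Submodule.mem_span_range_iff_exists_fun ℂ).1 (Submodule.span_mono ?_ hβ)
  rintro _ ⟨w, hw, rfl⟩
  obtain ⟨s, rfl⟩ := (cs L).length_eq_one_iff.1 hw
  exact ⟨s, rfl⟩

lemma inner_delta {L : ℕ} (v w : W L) [Decidable (v = w)] :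
    ⟪δ v, δ w⟫ = if v = w then 1 else 0 := by
  classical
  unfold δ
  rw [lp.inner_single_left, lp.single_apply, Pi.single_apply]
  by_cases h : v = w <;> simp [h]

lemma sum_coeff_eq_zero {L : ℕ} {c : Fin L → ℂ}
    (hc : ⟪∑ s, c s • δ (σ s), ∑ s : Fin L, δ (σ s)⟫ = 0) : ∑ s, c s = 0 := by
  classical
  have hconj : starRingEnd ℂ (∑ s, c s) = 0 := by
    simpa [sum_inner, inner_sum, inner_smul_left, inner_delta, simple_injective.eq_iff] using hc
  exact (map_eq_zero _).1 hconj

/-! ### The operators -/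

lemma rightOp_apply_sub_mem {L : ℕ} {p : ℝ} {Tr : Fin L → H L →L[ℂ] H L}
    (hTr : ∀ (s : Fin L) (w : W L),
      Tr s (δ w) =
        if len (w * σ s) < len w then δ (w * σ s) + (p : ℂ) • δ w else δ (w * σ s))
    {Twr : W L → H L →L[ℂ] H L} (hTwr1 : Twr 1 = 1)
    (hTwrrec : ∀ (s : Fin L) (w : W L), len (w * σ s) < len w →
      Twr w = Tr s ∘L Twr (w * σ s))
    (s : Fin L) (n : ℕ) (w : W L) (hw : len w = n) :
    Twr w (δ (σ s)) - (if len (σ s * w) < len w then 0 else δ (σ s * w)) ∈ VLe L n := by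
  induction n generalizing w with
  | zero =>
    obtain rfl : w = 1 := (cs L).length_eq_zero_iff.1 hw
    simp [hTwr1, len_one]
  | succ n ih =>
    obtain ⟨t, ht⟩ : ∃ t : Fin L, len (w * σ t) < len w := by
      refine (cs L).exists_rightDescent_of_ne_one (w := w) ?_
      rintro rfl
      simp [len_one] at hw
    obtain ⟨u, rfl⟩ : ∃ u : W L, w = u * σ t :=
      ⟨w * σ t, ((cs L).simple_mul_simple_cancel_right t).symm⟩
    have hu : u * σ t * σ t = u := (cs L).simple_mul_simple_cancel_right t
    rw [hTwrrec t _ ht]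
    rw [hu] at ht ⊢
    have hlen := len_mul_simple t u
    have hlen' := len_mul_simple t (σ s * u)
    have hsu := len_simple_mul s u
    specialize ih u (by omega)
    have hTb : Tr t _ ∈ VLe L (n + 1) := apply_mem_of_mem_VLe (fun v hv => by
      have := len_mul_simple t v
      rw [hTr]
      split_ifs
      · exact Submodule.add_mem _ (delta_mem_VLe (by omega))
          (Submodule.smul_mem _ _ (delta_mem_VLe (by omega)))
      · exact delta_mem_VLe (by omega)) ih
    rw [map_sub] at hTb
    rw [ContinuousLinearMap.comp_apply]
    refine (Submodule.sub_mem_iff_left _ ?_).1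
      (show _ - (Tr t (Twr u (δ (σ s))) -
        Tr t (if len (σ s * u) < len u then 0 else δ (σ s * u))) ∈ _ from ?_)
    · exact hTb
    rw [← mul_assoc, sub_sub_sub_cancel_left]
    by_cases h₁ : len (σ s * u) < len u
    · rw [if_pos h₁, if_pos (by omega), map_zero, sub_zero]
      exact Submodule.zero_mem _
    · rw [if_neg h₁, hTr]
      by_cases h₂ : len (σ s * u * σ t) < len (σ s * u)
      · rw [if_pos h₂, if_pos (by omega), sub_zero]
        exact Submodule.add_mem _ (delta_mem_VLe (by omega))
          (Submodule.smul_mem _ _ (delta_mem_VLe (by omega)))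
      · rw [if_neg h₂, if_neg (by omega), sub_self]
        exact Submodule.zero_mem _

lemma exists_sum_op_apply_firstLetterVector {L : ℕ} {p : ℝ} {T : Fin L → H L →L[ℂ] H L}
    (hT : ∀ (s : Fin L) (w : W L),
      T s (δ w) =
        if len (σ s * w) < len w then δ (σ s * w) + (p : ℂ) • δ w else δ (σ s * w))
    {c : Fin L → ℂ} (hc : ∑ s, c s = 0) (n : ℕ) :
    ∃ x ∈ V L (n + 2), ∑ s, T s (firstLetterVector c (n + 1)) =
      x + (p : ℂ) • firstLetterVector c (n + 1) - firstLetterVector c n := by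
  set κ := firstLetterCoeff c with hκ
  refine ⟨∑ s, ∑ v ∈ sphere L (n + 1),
    if len (σ s * v) < len v then 0 else κ v • δ (σ s * v), ?_, ?_⟩
  · refine Submodule.sum_mem _ fun s _ => Submodule.sum_mem _ fun v hv => ?_
    have := len_simple_mul s v
    rw [mem_sphere] at hv
    split_ifs
    · exact Submodule.zero_mem _
    · exact Submodule.smul_mem _ _ (delta_mem_V (by omega))
  have hdown : ∑ s : Fin L, ∑ v ∈ sphere L (n + 1),
      (if len (σ s * v) < len v then κ v • δ (σ s * v) else 0) = -firstLetterVector c n := by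
    simp only [fun s => sum_sphere_succ_descent n s fun v => κ v • δ (σ s * v)]
    rw [Finset.sum_comm, firstLetterVector, ← Finset.sum_neg_distrib]
    refine Finset.sum_congr rfl fun u _ => ?_
    rw [← neg_smul, ← sum_ascent hc, Finset.sum_smul]
    refine Finset.sum_congr rfl fun s _ => ?_
    split_ifs with h
    · rw [zero_smul]
    · rw [simple_mul_cancel, hκ, firstLetterCoeff_simple_mul c h]
  have hdiag : ∑ s : Fin L, ∑ v ∈ sphere L (n + 1),
      (if len (σ s * v) < len v then (p : ℂ) • κ v • δ v else 0) =
        (p : ℂ) • firstLetterVector c (n + 1) := by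
    rw [Finset.sum_comm, firstLetterVector, Finset.smul_sum]
    refine Finset.sum_congr rfl fun v hv => ?_
    obtain ⟨s, hs⟩ := exists_descent (mem_sphere.1 hv)
    exact sum_descent hs fun _ => (p : ℂ) • κ v • δ v
  rw [sub_eq_add_neg, ← hdown, ← hdiag, ← Finset.sum_add_distrib, ← Finset.sum_add_distrib]
  refine Finset.sum_congr rfl fun s _ => ?_
  rw [← Finset.sum_add_distrib, ← Finset.sum_add_distrib, firstLetterVector, map_sum]
  refine Finset.sum_congr rfl fun v _ => ?_
  rw [map_smul, hT]
  split_ifs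
  · rw [smul_add, smul_comm, zero_add, add_comm]
  · rw [add_zero, add_zero]

theorem statement6
    (L : ℕ) (hL : 3 ≤ L) (q p : ℝ) (hq : 0 < q) (hq1 : q ≤ 1)
    (hp : p = (q - 1) / Real.sqrt q)
    (T : Fin L → H L →L[ℂ] H L)
    (hT : ∀ (s : Fin L) (w : W L),
      T s (δ w) =
        if len (σ s * w) < len w then δ (σ s * w) + (p : ℂ) • δ w else δ (σ s * w))
    (h : H L →L[ℂ] H L) (hh : h = ∑ s, T s)
    (Tw : W L → H L →L[ℂ] H L) (hTw1 : Tw 1 = 1)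
    (hTwrec : ∀ (s : Fin L) (w : W L), len (σ s * w) < len w →
      Tw w = T s ∘L Tw (σ s * w))
    (hn : ℕ → H L →L[ℂ] H L)
    (hhn : ∀ n : ℕ, hn n = ∑' w : {w : W L // len w = n}, Tw (w : W L))
    (Tr : Fin L → H L →L[ℂ] H L)
    (hTr : ∀ (s : Fin L) (w : W L),
      Tr s (δ w) =
        if len (w * σ s) < len w then δ (w * σ s) + (p : ℂ) • δ w else δ (w * σ s))
    (Rh : H L →L[ℂ] H L) (hRh : Rh = ∑ s, Tr s)
    (Twr : W L → H L →L[ℂ] H L) (hTwr1 : Twr 1 = 1)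
    (hTwrrec : ∀ (s : Fin L) (w : W L), len (w * σ s) < len w →
      Twr w = Tr s ∘L Twr (w * σ s))
    (hnr : ℕ → H L →L[ℂ] H L)
    (hhnr : ∀ n : ℕ, hnr n = ∑' w : {w : W L // len w = n}, Twr (w : W L))
    (Q : ℕ → H L →L[ℂ] H L)
    (hQ : ∀ (l : ℕ) (w : W L), Q l (δ w) = if len w = l then δ w else 0)
    (β : H L)
    (hβmem : β ∈ V L 1)
    (hβperp : ∀ y ∈ Sl L Q h Rh 1, ⟪β, y⟫ = 0)
    (n : ℕ) :
    h (Q (0 + n + 1) (hn 0 (hnr n β))) =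
      Q (1 + n + 1) (hn 1 (hnr n β)) +
        (p : ℂ) • Q (0 + n + 1) (hn 0 (hnr n β)) -
          (if n = 0 then 0 else Q (0 + (n - 1) + 1) (hn 0 (hnr (n - 1) β))) := by
  obtain ⟨c, rfl⟩ := exists_coeff_of_mem_V_one hβmem
  have len_simple (s : Fin L) : len (σ s) = 1 := (cs L).length_simple s
  have hδ : h (δ 1) = ∑ s : Fin L, δ (σ s) := by
    simp [hh, hT, len_one]
  have hQδ : Q 1 (h (δ 1)) = ∑ s : Fin L, δ (σ s) := by
    simp [hδ, hQ, len_simple]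
  have hc : ∑ s, c s = 0 := by
    refine sum_coeff_eq_zero (hβperp _ (Submodule.subset_span (Or.inl ⟨δ 1, ?_, hQδ.symm⟩)))
    exact delta_mem_V len_one
  have hn0 : hn 0 = 1 := by
    rw [hhn, tsum_sphere, sphere_zero, Finset.sum_singleton, hTw1]
  have hn1 : hn 1 = h := by
    rw [hhn, tsum_sphere, sum_sphere_one, hh]
    refine Finset.sum_congr rfl fun s _ => ?_
    have hs : σ s * σ s = (1 : W L) := (cs L).simple_mul_simple_self s
    rw [hTwrec s (σ s) (by rw [hs, len_one, len_simple]; exact one_pos), hs, hTw1]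
    ext1 x
    rfl
  have hsplit (m : ℕ) : hnr m (∑ s, c s • δ (σ s)) - firstLetterVector c (m + 1) ∈ VLe L m := by
    rw [hhnr, tsum_sphere, firstLetterVector_succ, map_sum, ← Finset.sum_sub_distrib]
    refine Submodule.sum_mem _ fun s _ => ?_
    rw [map_smul, ← smul_sub, sum_apply, ← Finset.sum_sub_distrib]
    exact Submodule.smul_mem _ _ (Submodule.sum_mem _ fun w hw =>
      rightOp_apply_sub_mem hTr hTwr1 hTwrrec s m w (mem_sphere.1 hw))
  have hproj (m : ℕ) :
      Q (0 + m + 1) (hn 0 (hnr m (∑ s, c s • δ (σ s)))) = firstLetterVector c (m + 1) := by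
    have := proj_of_mem_VLe hQ (hsplit m) (Nat.lt_succ_self m)
    rw [map_sub, proj_of_mem_V hQ (firstLetterVector_mem_V c (m + 1)), if_pos rfl,
      sub_eq_zero] at this
    rw [hn0, zero_add]
    exact this
  have hhV {x : H L} {m : ℕ} (hx : x ∈ VLe L m) : h x ∈ VLe L (m + 1) := by
    refine apply_mem_of_mem_VLe (fun v hv => ?_) hx
    rw [hh, sum_apply]
    refine Submodule.sum_mem _ fun s _ => ?_
    have := len_simple_mul s v
    rw [hT]
    split_ifs
    · exact Submodule.add_mem _ (delta_mem_VLe (by omega))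
        (Submodule.smul_mem _ _ (delta_mem_VLe (by omega)))
    · exact delta_mem_VLe (by omega)
  obtain ⟨x, hx, hsum⟩ := exists_sum_op_apply_firstLetterVector hT hc n
  rw [← sum_apply, ← hh] at hsum
  have htop : Q (1 + n + 1) (hn 1 (hnr n (∑ s, c s • δ (σ s)))) = x := by
    have hlow := proj_of_mem_VLe hQ (hhV (hsplit n)) (Nat.lt_succ_self (n + 1))
    rw [map_sub, map_sub, sub_eq_zero] at hlow
    rw [hn1, show 1 + n + 1 = n + 1 + 1 by ring]
    refine hlow.trans ?_
    rw [hsum, map_sub, map_add, map_smul, proj_of_mem_V hQ hx,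
      proj_of_mem_V hQ (firstLetterVector_mem_V c (n + 1)),
      proj_of_mem_V hQ (firstLetterVector_mem_V c n), if_pos rfl, if_neg (by omega),
      if_neg (by omega), smul_zero, add_zero, sub_zero]
  have hprev : (if n = 0 then 0 else
      Q (0 + (n - 1) + 1) (hn 0 (hnr (n - 1) (∑ s, c s • δ (σ s))))) = firstLetterVector c n := by
    cases n with
    | zero => simp [firstLetterVector_zero]
    | succ m => rw [if_neg m.succ_ne_zero, hproj, Nat.add_sub_cancel]
  rw [hprev, hproj, htop, hsum]

end UCoxMasa
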